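/- Let G be a countable digraph with vertex b and I ⊆ V(G) \ {b} such that every finite subset of I can be linked to b by pairwise edge-disjoint directed paths. Then there is a family (P_v | v ∈ I) of pairwise edge-disjoint directed paths or rays, where P_v starts at v and either ends at b or dominates b (i.e., there are infinitely many pairwise edge-disjoint directed paths from P_v to b, edge-disjoint among themselves). -/

import Mathlib

/-- A (finite) directed path in the digraph with adjacency `Adj`:
a nonempty list of distinct vertices whose consecutive pairs are edges. -/
structure DiPath {V : Type*} (Adj : V → V → Prop) : Type _ where
  verts : List V
  ne : verts ≠ []
  chain : verts.Chain' Adj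
  nodup : verts.Nodup

namespace DiPath
variable {V : Type*} {Adj : V → V → Prop}
/-- The first vertex of a directed path. -/
def first (P : DiPath Adj) : V := P.verts.head P.ne
/-- The last vertex of a directed path. -/
def last (P : DiPath Adj) : V := P.verts.getLast P.ne
/-- The (directed) edges of a path, as ordered pairs of consecutive vertices. -/
def edges (P : DiPath Adj) : List (V × V) := P.verts.zip P.verts.tail
/-- The edge set of a path. -/
def edgeSet (P : DiPath Adj) : Set (V × V) := {e | e ∈ P.edges}
/-- The vertex set of a path. -/
def vertexSet (P : DiPath Adj) : Set V := {v | v ∈ P.verts}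
end DiPath

/-- A directed ray: a one-way infinite directed path. -/
structure DiRay {V : Type*} (Adj : V → V → Prop) : Type _ where
  f : ℕ → V
  inj : Function.Injective f
  adj : ∀ n, Adj (f n) (f (n + 1))

namespace DiRay
variable {V : Type*} {Adj : V → V → Prop}
/-- The first vertex of a ray. -/
def first (R : DiRay Adj) : V := R.f 0
/-- The edge set of a ray. -/
def edgeSet (R : DiRay Adj) : Set (V × V) := Set.range fun n => (R.f n, R.f (n + 1))
/-- The vertex set of a ray. -/
def vertexSet (R : DiRay Adj) : Set V := Set.range R.f
end DiRay

/-- A path or a ray. -/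
inductive PR {V : Type*} (Adj : V → V → Prop) : Type _
  | path : DiPath Adj → PR Adj
  | ray : DiRay Adj → PR Adj

namespace PR
variable {V : Type*} {Adj : V → V → Prop}
/-- The first vertex. -/
def first : PR Adj → V
  | .path P => P.first
  | .ray R => R.first
/-- The edge set. -/
def edgeSet : PR Adj → Set (V × V)
  | .path P => P.edgeSet
  | .ray R => R.edgeSet
/-- The vertex set. -/
def vertexSet : PR Adj → Set V
  | .path P => P.vertexSet
  | .ray R => R.vertexSet
end PR

/-- A vertex `v` dominates `b` (edge version): there are infinitely many
pairwise edge-disjoint directed `v`–`b` paths. -/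
def VDom {V : Type*} (Adj : V → V → Prop) (b v : V) : Prop :=
  ∃ P : ℕ → DiPath Adj, Function.Injective P ∧ (∀ n, (P n).first = v) ∧
    (∀ n, (P n).last = b) ∧ ∀ m n, m ≠ n → Disjoint (P m).edgeSet (P n).edgeSet

/-- A ray `R` dominates `b` (edge version): there are infinitely many pairwise
edge-disjoint directed paths from `R` to `b`. -/
def RDom {V : Type*} (Adj : V → V → Prop) (b : V) (R : DiRay Adj) : Prop :=
  ∃ P : ℕ → DiPath Adj, Function.Injective P ∧ (∀ n, (P n).first ∈ R.vertexSet) ∧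
    (∀ n, (P n).last = b) ∧ ∀ m n, m ≠ n → Disjoint (P m).edgeSet (P n).edgeSet

/-- A path or ray is good for `b` if it ends at `b` or dominates `b`
(a path dominates `b` if its last vertex does; a ray dominates as a ray). -/
def PR.Good {V : Type*} {Adj : V → V → Prop} (b : V) : PR Adj → Prop
  | .path P => P.last = b ∨ VDom Adj b P.last
  | .ray R => RDom Adj b R

/-- A domination linkage (edge version) from `I` to `b`: pairwise edge-disjoint
paths or rays, one starting at each vertex of `I`, each ending at `b` or dominating `b`. -/
def DomLinkage {V : Type*} (Adj : V → V → Prop) (b : V) (I : Set V) : Prop :=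
  ∃ Q : I → PR Adj, (∀ v : I, (Q v).first = (v : V)) ∧ (∀ v, (Q v).Good b) ∧
    ∀ v w : I, v ≠ w → Disjoint (Q v).edgeSet (Q w).edgeSet

/-- The finite set `S` can be linked to `b` by pairwise edge-disjoint directed paths,
one starting at each vertex of `S`, each ending at `b`. -/
def FinLinked {V : Type*} (Adj : V → V → Prop) (b : V) (S : Finset V) : Prop :=
  ∃ P : S → DiPath Adj, (∀ s, (P s).first = (s : V)) ∧ (∀ s, (P s).last = b) ∧
    ∀ s t, s ≠ t → Disjoint (P s).edgeSet (P t).edgeSet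

open Relation

section Paths
variable {V : Type*}

theorem exists_nodup_isChain {r : V → V → Prop} {u v : V} (h : ReflTransGen r u v) :
    ∃ l : List V, (u :: l).Nodup ∧ (u :: l).IsChain r ∧
      (u :: l).getLast (List.cons_ne_nil u l) = v := by
  induction h using ReflTransGen.head_induction_on with
  | refl => exact ⟨[], by simp, by simp, by simp⟩
  | @head x y hxy _ ih =>
    obtain ⟨l, hn, hc, hl⟩ := ih
    by_cases hx : x ∈ y :: l
    · obtain ⟨s, t, hst⟩ := List.append_of_mem hx
      refine ⟨t, ?_, ?_, ?_⟩
      · rw [hst] at hn; exact hn.of_append_right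
      · rw [hst] at hc; exact hc.right_of_append
      · rw [← hl]; simp [hst]
    · exact ⟨y :: l, List.nodup_cons.2 ⟨hx, hn⟩, List.isChain_cons_cons.2 ⟨hxy, hc⟩,
        by simpa using hl⟩

theorem rel_of_mem_zip_tail {r : V → V → Prop} {l : List V} (hl : l.IsChain r) :
    ∀ e ∈ l.zip l.tail, r e.1 e.2 := by
  induction l with
  | nil => simp
  | cons x l ih =>
    cases l with
    | nil => simp
    | cons y l =>
      rw [List.isChain_cons_cons] at hl
      intro e he
      simp only [List.tail_cons, List.zip_cons_cons, List.mem_cons] at he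
      rcases he with rfl | he
      · exact hl.1
      · exact ih hl.2 e (by simpa using he)

/-- The edges of `E` leaving the vertex set `X`. -/
def outCut (E : Set (V × V)) (X : Set V) : Set (V × V) := {e | e ∈ E ∧ e.1 ∈ X ∧ e.2 ∉ X}

theorem exists_mem_zip_tail_leaving {X : Set V} {l : List V} {u : V} (hu : u ∈ X)
    (hl : (u :: l).getLast (List.cons_ne_nil u l) ∉ X) :
    ∃ e ∈ (u :: l).zip l, e.1 ∈ X ∧ e.2 ∉ X := by
  induction l generalizing u with
  | nil => exact absurd hu (by simpa using hl)
  | cons y l ih =>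
    by_cases hy : y ∈ X
    · obtain ⟨e, he, h⟩ := ih hy (by simpa using hl)
      exact ⟨e, by simp [List.zip_cons_cons, he], h⟩
    · exact ⟨(u, y), by simp, hu, hy⟩

end Paths

section Flow
variable {V : Type*}

/-- The net flow out of the weight function `g` along the finite edge set `F`. -/
def netOut (F : Finset (V × V)) (g : V → ℤ) : ℤ := ∑ e ∈ F, (g e.1 - g e.2)

theorem netOut_indicator (F : Finset (V × V)) (X : Set V) :
    netOut F (X.indicator 1) = (outCut (F : Set (V × V)) X).ncard -
      (outCut (F : Set (V × V)) Xᶜ).ncard := by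
  classical
  have h (Y : Set V) : outCut (F : Set (V × V)) Y =
      ((F.filter fun e => e.1 ∈ Y ∧ e.2 ∉ Y : Finset (V × V)) : Set (V × V)) := by
    ext e; simp [outCut]
  rw [h, h, Set.ncard_coe_finset, Set.ncard_coe_finset, Finset.card_filter, Finset.card_filter]
  push_cast
  rw [netOut, ← Finset.sum_sub_distrib]
  refine Finset.sum_congr rfl fun e _ => ?_
  by_cases h1 : e.1 ∈ X <;> by_cases h2 : e.2 ∈ X <;> simp [h1, h2]

/-- The arcs of the residual digraph of the edge set `F` inside `E`. -/
def Residual (E : Set (V × V)) (F : Finset (V × V)) (x y : V) : Prop :=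
  ((x, y) ∈ E ∧ (x, y) ∉ F) ∨ (y, x) ∈ F

theorem exists_augmentation {E : Set (V × V)} (l : List V) (w : V) (F : Finset (V × V))
    (hF : (F : Set (V × V)) ⊆ E) (hn : (w :: l).Nodup) (hc : (w :: l).IsChain (Residual E F)) :
    ∃ F' : Finset (V × V), (F' : Set (V × V)) ⊆ E ∧ ∀ g, netOut F' g =
      netOut F g + (g w - g ((w :: l).getLast (List.cons_ne_nil w l))) := by
  classical
  induction l generalizing w F with
  | nil => exact ⟨F, hF, by simp⟩
  | cons v l ih =>
    rw [List.isChain_cons_cons] at hc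
    rw [List.nodup_cons] at hn
    have hw (x) (hx : x ∈ v :: l) : x ≠ w := fun h => hn.1 (h ▸ hx)
    have key : ∃ F₁ : Finset (V × V), (F₁ : Set (V × V)) ⊆ E ∧
        (∀ g, netOut F₁ g = netOut F g + (g w - g v)) ∧
        ∀ x y, x ≠ w → y ≠ w → ((x, y) ∈ F₁ ↔ (x, y) ∈ F) := by
      rcases hc.1 with ⟨hE, hnF⟩ | hvF
      · refine ⟨insert (w, v) F, ?_, fun g => ?_, fun x y hx _ => ?_⟩
        · rw [Finset.coe_insert]; exact Set.insert_subset hE hF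
        · rw [netOut, Finset.sum_insert hnF, netOut]; ring
        · simp [hx]
      · refine ⟨F.erase (v, w), ?_, fun g => ?_, fun x y _ hy => ?_⟩
        · exact (Finset.coe_subset.2 (Finset.erase_subset _ _)).trans hF
        · have := Finset.add_sum_erase F (fun e => g e.1 - g e.2) hvF
          simp only [netOut] at this ⊢
          linarith
        · simp [hy]
    obtain ⟨F₁, h1, h2, h3⟩ := key
    obtain ⟨F', h4, h5⟩ := ih v F₁ h1 hn.2 (hc.2.imp_of_mem_imp fun x y hx hy h => by
      unfold Residual at *
      rwa [h3 x y (hw x hx) (hw y hy), h3 y x (hw y hy) (hw x hx)])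
    refine ⟨F', h4, fun g => ?_⟩
    rw [h5, h2, List.getLast_cons (List.cons_ne_nil v l)]
    ring

theorem sum_indicator_eq_ncard {ι : Type*} (J : Finset ι) (a : ι → V) {b : V} {X : Set V}
    (hb : b ∉ X) :
    ∑ j ∈ J, (X.indicator (1 : V → ℤ) (a j) - X.indicator (1 : V → ℤ) b) =
      ({j | j ∈ J ∧ a j ∈ X}.ncard : ℤ) := by
  classical
  have h : {j | j ∈ J ∧ a j ∈ X} = ((J.filter fun j => a j ∈ X : Finset ι) : Set ι) := by
    ext; simp
  rw [h, Set.ncard_coe_finset, Finset.card_filter]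
  push_cast
  refine Finset.sum_congr rfl fun j _ => ?_
  by_cases h1 : a j ∈ X <;> simp [h1, hb]

/-- Edge version of Menger's theorem: the cut condition yields an integral flow
with one unit starting at each `a j` and all units ending at `b`. -/
theorem exists_flow {ι : Type*} (J : Finset ι) (a : ι → V) (E : Set (V × V)) (b : V)
    (h : ∀ X : Set V, b ∉ X → {j | j ∈ J ∧ a j ∈ X}.encard ≤ (outCut E X).encard) :
    ∃ F : Finset (V × V), (F : Set (V × V)) ⊆ E ∧ ∀ g, netOut F g = ∑ j ∈ J, (g (a j) - g b) := by
  classical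
  induction J using Finset.induction_on with
  | empty => exact ⟨∅, by simp, by simp [netOut]⟩
  | @insert i J hi ih =>
    have hsub (X : Set V) : {j | j ∈ J ∧ a j ∈ X} ⊆ {j | j ∈ insert i J ∧ a j ∈ X} :=
      fun j hj => ⟨Finset.mem_insert_of_mem hj.1, hj.2⟩
    obtain ⟨F, hF, hg⟩ := ih fun X hX => (Set.encard_le_encard (hsub X)).trans (h X hX)
    by_cases hr : ReflTransGen (Residual E F) (a i) b
    · obtain ⟨l, hn, hc, hl⟩ := exists_nodup_isChain hr
      obtain ⟨F', h1, h2⟩ := exists_augmentation l _ F hF hn hc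
      refine ⟨F', h1, fun g => ?_⟩
      rw [h2, hl, hg, Finset.sum_insert hi]
      ring
    · exfalso
      set X : Set V := {v | ReflTransGen (Residual E F) (a i) v}
      have hbX : b ∉ X := hr
      have hin : outCut (F : Set (V × V)) Xᶜ = ∅ := by
        ext e
        simp only [outCut, Set.mem_ofPred_eq, Set.mem_compl_iff, not_not, Set.mem_empty_iff_false,
          iff_false]
        rintro ⟨he, h1, h2⟩
        exact h1 (h2.tail (Or.inr he))
      have hout : outCut E X ⊆ outCut (F : Set (V × V)) X := by
        rintro e ⟨he, h1, h2⟩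
        refine ⟨?_, h1, h2⟩
        by_contra hF'
        exact h2 (h1.tail (Or.inl ⟨he, hF'⟩))
      have hfin : (outCut (F : Set (V × V)) X).Finite := F.finite_toSet.subset fun e he => he.1
      have hnet := netOut_indicator F X
      rw [hg, sum_indicator_eq_ncard J a hbX, hin, Set.ncard_empty] at hnet
      have h1 := (h X hbX).trans (Set.encard_le_encard hout)
      have hins : {j | j ∈ insert i J ∧ a j ∈ X} = insert i {j | j ∈ J ∧ a j ∈ X} := by
        ext j
        simp only [Finset.mem_insert, Set.mem_ofPred_eq, Set.mem_insert_iff]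
        constructor
        · exact fun h => h.1.imp id fun hj => ⟨hj, h.2⟩
        · rintro (rfl | hj)
          · exact ⟨Or.inl rfl, ReflTransGen.refl⟩
          · exact ⟨Or.inr hj.1, hj.2⟩
      have hJfin : {j | j ∈ J ∧ a j ∈ X}.Finite := J.finite_toSet.subset fun j hj => hj.1
      rw [hins, Set.encard_insert_of_notMem (fun h => hi h.1), ← hJfin.cast_ncard_eq,
        ← hfin.cast_ncard_eq] at h1
      norm_cast at h1
      omega

end Flow

section Exit
variable {V ι : Type*}

theorem ncard_outCut_inter_add_union {E : Set (V × V)} {X Z : Set V}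
    (hX : (outCut E X).Finite) (hZ : (outCut E Z).Finite) :
    (outCut E (X ∩ Z)).ncard + (outCut E (X ∪ Z)).ncard +
      {e | e ∈ E ∧ e.1 ∈ Z \ X ∧ e.2 ∈ X \ Z}.ncard ≤
    (outCut E X).ncard + (outCut E Z).ncard := by
  classical
  obtain ⟨B, hB⟩ := (hX.union hZ).exists_finset_coe
  have hmem (e : V × V) : e ∈ B ↔ e ∈ outCut E X ∨ e ∈ outCut E Z := by
    rw [← Finset.mem_coe, hB, Set.mem_union]
  have card (S : Set (V × V)) (hS : ∀ e ∈ S, e ∈ outCut E X ∨ e ∈ outCut E Z) :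
      S.ncard = ∑ e ∈ B, if e ∈ S then 1 else 0 := by
    rw [← Finset.card_filter, ← Set.ncard_coe_finset]
    congr 1
    ext e
    simp only [Finset.coe_filter, Set.mem_ofPred_eq, hmem]
    exact ⟨fun h => ⟨hS e h, h⟩, fun h => h.2⟩
  rw [card (outCut E (X ∩ Z)), card (outCut E (X ∪ Z)), card (outCut E X), card (outCut E Z),
    card {e | e ∈ E ∧ e.1 ∈ Z \ X ∧ e.2 ∈ X \ Z}, ← Finset.sum_add_distrib,
    ← Finset.sum_add_distrib, ← Finset.sum_add_distrib]
  · refine Finset.sum_le_sum fun e _ => ?_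
    by_cases h0 : e ∈ E <;> by_cases h1 : e.1 ∈ X <;> by_cases h2 : e.2 ∈ X <;>
      by_cases h3 : e.1 ∈ Z <;> by_cases h4 : e.2 ∈ Z <;>
      simp [outCut, h0, h1, h2, h3, h4]
  all_goals
    intro e he
    simp only [outCut, Set.mem_ofPred_eq, Set.mem_inter_iff, Set.mem_union, Set.mem_sdiff] at he ⊢
    tauto

/-- One token moves along an edge, and this edge is deleted. -/
def Step (σ τ : (ι → V) × Set (V × V)) : Prop :=
  ∃ i y, (σ.1 i, y) ∈ σ.2 ∧ (∀ j, j ≠ i → τ.1 j = σ.1 j) ∧ τ.1 i = y ∧ τ.2 = σ.2 \ {(σ.1 i, y)}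

/-- The cut condition for linking the tokens to `b` in the remaining edges. -/
def Feasible (b : V) (σ : (ι → V) × Set (V × V)) : Prop :=
  ∀ X : Set V, b ∉ X → (σ.1 ⁻¹' X).encard ≤ (outCut σ.2 X).encard

theorem exists_trail [DecidableEq ι] {r : V → V → Prop} (i : ι) {w x : V}
    (h : ReflTransGen r w x) :
    ∃ T : Finset (V × V), (∀ e ∈ T, r e.1 e.2) ∧ (∀ g, netOut T g = g w - g x) ∧
      ∀ σ : (ι → V) × Set (V × V), σ.1 i = w → (T : Set (V × V)) ⊆ σ.2 →
        ReflTransGen Step σ (Function.update σ.1 i x, σ.2 \ T) := by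
  classical
  obtain ⟨l, hn, hc, rfl⟩ := exists_nodup_isChain h
  clear h
  suffices H : ∃ T : Finset (V × V), (∀ e ∈ T, e.1 ∈ w :: l) ∧ (∀ e ∈ T, r e.1 e.2) ∧
      (∀ g, netOut T g = g w - g ((w :: l).getLast (List.cons_ne_nil w l))) ∧
      ∀ σ : (ι → V) × Set (V × V), σ.1 i = w → (T : Set (V × V)) ⊆ σ.2 →
        ReflTransGen Step σ (Function.update σ.1 i
          ((w :: l).getLast (List.cons_ne_nil w l)), σ.2 \ T) from by
    obtain ⟨T, -, h⟩ := H
    exact ⟨T, h⟩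
  induction l generalizing w with
  | nil =>
    refine ⟨∅, by simp, by simp, by simp [netOut], ?_⟩
    rintro ⟨p, E⟩ rfl -
    simp only [List.getLast_singleton, Function.update_eq_self, Finset.coe_empty, Set.sdiff_empty]
    exact ReflTransGen.refl
  | cons v l ih =>
    rw [List.isChain_cons_cons] at hc
    rw [List.nodup_cons] at hn
    obtain ⟨T, h1, h2, h3, h4⟩ := ih hn.2 hc.2
    have hT : (w, v) ∉ T := fun h => hn.1 (h1 _ h)
    refine ⟨insert (w, v) T, ?_, ?_, ?_, ?_⟩
    · simp only [Finset.forall_mem_insert]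
      exact ⟨by simp, fun e he => List.mem_cons_of_mem _ (h1 e he)⟩
    · simp only [Finset.forall_mem_insert]
      exact ⟨hc.1, h2⟩
    · intro g
      rw [netOut, Finset.sum_insert hT, ← netOut, h3, List.getLast_cons (List.cons_ne_nil v l)]
      ring
    · rintro ⟨p, E⟩ rfl hTE
      rw [Finset.coe_insert, Set.insert_subset_iff] at hTE
      have := h4 (Function.update p i v, E \ {(p i, v)}) (by simp)
        (fun e he => ⟨hTE.2 he, fun h => hT (by rw [← Set.mem_singleton_iff.1 h]; exact he)⟩)
      rw [List.getLast_cons (List.cons_ne_nil v l)]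
      refine ReflTransGen.head ?_ (by
        simpa only [Function.update_idem, Set.sdiff_sdiff, Set.singleton_union,
          ← Finset.coe_insert] using this)
      exact ⟨i, v, hTE.1, fun j hj => by simp [hj], by simp, rfl⟩

theorem ncard_preimage_eq_add_indicator {q : ι → V} {X : Set V} (i : ι)
    (h : ((q ⁻¹' X) \ {i}).Finite) :
    ((q ⁻¹' X).ncard : ℤ) = ((q ⁻¹' X) \ {i}).ncard + X.indicator 1 (q i) ∧
      (q ⁻¹' X).Finite := by
  by_cases hi : q i ∈ X
  · have hins : q ⁻¹' X = insert i ((q ⁻¹' X) \ {i}) := by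
      rw [Set.insert_sdiff_singleton, Set.insert_eq_of_mem (show i ∈ q ⁻¹' X from hi)]
    have hf : (q ⁻¹' X).Finite := by rw [hins]; exact h.insert i
    refine ⟨?_, hf⟩
    rw [← Set.ncard_sdiff_singleton_add_one (show i ∈ q ⁻¹' X from hi) hf]
    simp [hi]
  · rw [Set.sdiff_singleton_eq_self (show i ∉ q ⁻¹' X from hi)] at h ⊢
    exact ⟨by simp [hi], h⟩

theorem exists_exit {b : V} {σ : (ι → V) × Set (V × V)} (hσ : Feasible b σ) {i : ι} {Z₀ : Set V}
    (hi₀ : σ.1 i ∈ Z₀) (hb₀ : b ∉ Z₀) (hfin₀ : (outCut σ.2 Z₀).Finite) :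
    ∃ τ, ReflTransGen Step σ τ ∧ Feasible b τ ∧ τ.1 i ∉ Z₀ := by
  classical
  obtain ⟨p, E⟩ := σ
  simp only at hi₀ hfin₀
  have hp {X : Set V} (hbX : b ∉ X) (hX : (outCut E X).Finite) :
      (p ⁻¹' X).Finite ∧ (p ⁻¹' X).ncard ≤ (outCut E X).ncard := by
    have h : (p ⁻¹' X).encard ≤ (outCut E X).encard := hσ X hbX
    have hf : (p ⁻¹' X).Finite := Set.finite_of_encard_le_coe (h.trans hX.cast_ncard_eq.symm.le)
    rw [← hf.cast_ncard_eq, ← hX.cast_ncard_eq] at h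
    exact ⟨hf, by exact_mod_cast h⟩
  obtain ⟨Z, ⟨hZ₀, hbZ, hZ⟩, hmin⟩ := WellFounded.has_min
    (measure fun X : Set V => (outCut E X).ncard - (p ⁻¹' X).ncard).wf
    {X | Z₀ ⊆ X ∧ b ∉ X ∧ (outCut E X).Finite} ⟨Z₀, subset_rfl, hb₀, hfin₀⟩
  have hiZ : p i ∈ Z := hZ₀ hi₀
  obtain ⟨J, hJ⟩ := (hp hbZ hZ).1.exists_finset_coe
  have hJmem (j : ι) : j ∈ J ↔ p j ∈ Z := by rw [← Finset.mem_coe, hJ]; rfl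
  obtain ⟨F, hFE, hF⟩ := exists_flow J p E b fun X hX =>
    le_trans (Set.encard_le_encard fun j hj => hj.2) (hσ X hX)
  have hFnet {X : Set V} (hXZ : X ⊆ Z) : ((p ⁻¹' X).ncard : ℤ) =
      (outCut (F : Set (V × V)) X).ncard - (outCut (F : Set (V × V)) Xᶜ).ncard := by
    rw [← netOut_indicator, hF, sum_indicator_eq_ncard J p fun h => hbZ (hXZ h)]
    congr 2
    ext j
    simp only [Set.mem_preimage, Set.mem_ofPred_eq, hJmem]
    exact ⟨fun h => ⟨hXZ h, h⟩, fun h => h.2⟩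
  have hreach : ∃ x, x ∉ Z ∧ ReflTransGen (fun x y => (x, y) ∈ F ∧ x ∈ Z) (p i) x := by
    by_contra! hcon
    set X : Set V := {x | ReflTransGen (fun x y => (x, y) ∈ F ∧ x ∈ Z) (p i) x}
    have hXZ : X ⊆ Z := fun x hx => by
      by_contra hxZ
      exact hcon x hxZ hx
    have hempty : outCut (F : Set (V × V)) X = ∅ := by
      ext e
      simp only [outCut, Set.mem_ofPred_eq, Set.mem_empty_iff_false, iff_false]
      rintro ⟨he, h1, h2⟩
      exact h2 (ReflTransGen.tail (show ReflTransGen _ _ _ from h1) ⟨he, hXZ h1⟩)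
    have h1 := hFnet hXZ
    rw [hempty, Set.ncard_empty] at h1
    have h2 : (p ⁻¹' X).ncard = 0 := by omega
    rw [Set.ncard_eq_zero ((hp hbZ hZ).1.subset (Set.preimage_mono hXZ))] at h2
    exact h2.le (show p i ∈ X from ReflTransGen.refl)
  obtain ⟨x, hxZ, hx⟩ := hreach
  obtain ⟨T, hTr, hTnet, hTstep⟩ := exists_trail i hx
  have hTE : (T : Set (V × V)) ⊆ E := fun e he => hFE (hTr e he).1
  refine ⟨_, hTstep (p, E) rfl hTE, fun X hbX => ?_, by simpa using fun h => hxZ (hZ₀ h)⟩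
  by_cases hX' : (outCut (E \ T) X).Finite
  swap
  · simp only
    rw [Set.Infinite.encard_eq hX']
    exact le_top
  have hsplit : outCut E X = outCut (E \ T) X ∪ outCut T X := by
    ext e
    have := @hTE e
    simp only [outCut, Set.mem_union, Set.mem_ofPred_eq, Set.mem_sdiff] at this ⊢
    tauto
  have hTfin (Y : Set V) : (outCut (T : Set (V × V)) Y).Finite :=
    T.finite_toSet.subset fun e he => he.1
  have hX : (outCut E X).Finite := by rw [hsplit]; exact hX'.union (hTfin X)
  have hcard : (outCut E X).ncard =
      (outCut (E \ T) X).ncard + (outCut (T : Set (V × V)) X).ncard := by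
    rw [hsplit, Set.ncard_union_eq _ hX' (hTfin X)]
    exact Set.disjoint_left.2 fun e he he' => he.1.2 he'.1
  have hcutfin (Y : Set V) (hY : outCut E Y ⊆ outCut E X ∪ outCut E Z) : (outCut E Y).Finite :=
    (hX.union hZ).subset hY
  have hI : (outCut E (X ∩ Z)).Finite := hcutfin _ fun e he => by
    simp only [outCut, Set.mem_union, Set.mem_ofPred_eq, Set.mem_inter_iff] at he ⊢
    tauto
  have hU : (outCut E (X ∪ Z)).Finite := hcutfin _ fun e he => by
    simp only [outCut, Set.mem_union, Set.mem_ofPred_eq] at he ⊢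
    tauto
  have hbU : b ∉ X ∪ Z := fun h => h.elim hbX hbZ
  have hbI : b ∉ X ∩ Z := fun h => hbX h.1
  have hsub := ncard_outCut_inter_add_union hX hZ
  have hmod := Set.ncard_union_add_ncard_inter (p ⁻¹' X) (p ⁻¹' Z) (hp hbX hX).1 (hp hbZ hZ).1
  rw [← Set.preimage_union, ← Set.preimage_inter] at hmod
  have hminU : ¬ ((outCut E (X ∪ Z)).ncard - (p ⁻¹' (X ∪ Z)).ncard <
      (outCut E Z).ncard - (p ⁻¹' Z).ncard) :=
    hmin (X ∪ Z) ⟨hZ₀.trans Set.subset_union_right, hbU, hU⟩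
  have hFI := hFnet (X := X ∩ Z) Set.inter_subset_right
  have hFout : (outCut (F : Set (V × V)) (X ∩ Z)).ncard ≤ (outCut E (X ∩ Z)).ncard :=
    Set.ncard_le_ncard (fun e he => ⟨hFE he.1, he.2⟩) hI
  have henter : (outCut (T : Set (V × V)) Xᶜ).ncard ≤
      (outCut (F : Set (V × V)) (X ∩ Z)ᶜ).ncard +
        {e | e ∈ E ∧ e.1 ∈ Z \ X ∧ e.2 ∈ X \ Z}.ncard := by
    refine le_trans (Set.ncard_le_ncard (fun e he => ?_) (Set.Finite.union ?_ ?_))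
      (Set.ncard_union_le _ _)
    · obtain ⟨he, h1, h2⟩ := he
      obtain ⟨h3, h4⟩ := hTr e he
      have h5 := hFE h3
      simp only [outCut, Set.mem_union, Set.mem_ofPred_eq, Set.mem_sdiff, Set.mem_compl_iff,
        Set.mem_inter_iff, not_not] at h1 h2 ⊢
      tauto
    · exact F.finite_toSet.subset fun e he => he.1
    · exact hZ.subset fun e he => ⟨he.1, he.2.1.1, he.2.2.2⟩
  have hTX := netOut_indicator T X
  rw [hTnet] at hTX
  have hupd : ((Function.update p i x ⁻¹' X).ncard : ℤ) = (p ⁻¹' X).ncard -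
      X.indicator 1 (p i) + X.indicator 1 x ∧ (Function.update p i x ⁻¹' X).Finite := by
    have hoff : (Function.update p i x ⁻¹' X) \ {i} = (p ⁻¹' X) \ {i} := by
      ext j
      by_cases hj : j = i <;> simp [hj]
    have hf : ((p ⁻¹' X) \ {i}).Finite := (hp hbX hX).1.subset Set.sdiff_subset
    have h1 := ncard_preimage_eq_add_indicator i hf
    have h2 := ncard_preimage_eq_add_indicator (q := Function.update p i x) i (hoff ▸ hf)
    rw [hoff, Function.update_self] at h2
    exact ⟨by rw [h1.1, h2.1]; ring, h2.2⟩
  simp only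
  rw [← hupd.2.cast_ncard_eq, ← hX'.cast_ncard_eq]
  have h1 := (hp hbX hX).2
  have h2 := (hp hbZ hZ).2
  have h3 := (hp hbU hU).2
  have h4 := (hp hbI hI).2
  have h5 := hupd.1
  norm_cast
  zify at *
  omega

end Exit

section Sequences

theorem exists_seq_of_reflTransGen {α : Type*} {r : α → α → Prop} {good : α → Prop}
    {D : ℕ → α → Prop} {a₀ : α} (h₀ : good a₀)
    (h : ∀ k a, good a → ∃ c, ReflTransGen r a c ∧ good c ∧ D k c) :
    ∃ s : ℕ → α, s 0 = a₀ ∧ (∀ n, s (n + 1) = s n ∨ r (s n) (s (n + 1))) ∧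
      ∀ k, ∃ n, k ≤ n ∧ D k (s n) := by
  have hplan : ∀ k a, good a → ∃ l : List α, (a :: l).IsChain r ∧
      good ((a :: l).getLast (List.cons_ne_nil a l)) ∧
      D k ((a :: l).getLast (List.cons_ne_nil a l)) := by
    intro k a ha
    obtain ⟨c, hc, hg, hD⟩ := h k a ha
    obtain ⟨l, -, h1, rfl⟩ := exists_nodup_isChain hc
    exact ⟨l, h1, hg, hD⟩
  choose! plan hplan using hplan
  let next : ℕ × α × List α → ℕ × α × List α := fun x =>
    match x with
    | (k, a, []) => (k + 1, a, plan k a)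
    | (k, _, c :: l) => (k, c, l)
  let st : ℕ → ℕ × α × List α := fun n => next^[n] (0, a₀, [])
  have hst (n) : st (n + 1) = next (st n) := Function.iterate_succ_apply' _ _ _
  have hinv (n) : ((st n).2.1 :: (st n).2.2).IsChain r ∧
      good (((st n).2.1 :: (st n).2.2).getLast (List.cons_ne_nil _ _)) ∧
      ∀ k, (st n).1 = k + 1 → D k (((st n).2.1 :: (st n).2.2).getLast (List.cons_ne_nil _ _)) := by
    induction n with
    | zero => exact ⟨by simp [st], by simpa [st] using h₀, by simp [st]⟩
    | succ n ih =>
      rw [hst]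
      generalize st n = x at ih
      obtain ⟨k, a, _ | ⟨c, l⟩⟩ := x
      · have := hplan k a (by simpa using ih.2.1)
        refine ⟨this.1, this.2.1, ?_⟩
        rintro k' hk
        obtain rfl : k = k' := by simpa [next] using hk
        exact this.2.2
      · exact ⟨ih.1.tail, by simpa [next] using ih.2.1, by simpa [next] using ih.2.2⟩
  have hfinish (l : List α) : ∀ m k a, st m = (k, a, l) → ∃ n c, m ≤ n ∧ st n = (k, c, []) := by
    induction l with
    | nil => exact fun m k a hm => ⟨m, a, le_rfl, hm⟩
    | cons c l ih =>
      intro m k a hm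
      obtain ⟨n, d, h1, h2⟩ := ih (m + 1) k c (by rw [hst, hm])
      exact ⟨n, d, by omega, h2⟩
  have hidle (k) : ∃ n a, k ≤ n ∧ st n = (k, a, []) := by
    induction k with
    | zero => exact ⟨0, a₀, le_rfl, rfl⟩
    | succ k ih =>
      obtain ⟨n, a, h1, h2⟩ := ih
      obtain ⟨m, c, h3, h4⟩ := hfinish (plan k a) (n + 1) (k + 1) a (by rw [hst, h2])
      exact ⟨m, c, by omega, h4⟩
  refine ⟨fun n => (st n).2.1, rfl, fun n => ?_, fun k => ?_⟩
  · have h1 := (hinv n).1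
    simp only [hst]
    generalize st n = x at h1
    obtain ⟨k, a, _ | ⟨c, l⟩⟩ := x
    · exact Or.inl rfl
    · exact Or.inr (List.isChain_cons_cons.1 h1).1
  · obtain ⟨n, a, h1, h2⟩ := hidle (k + 1)
    refine ⟨n, by omega, ?_⟩
    have := (hinv n).2.2 k (by rw [h2])
    simp only [h2] at this ⊢
    simpa using this

end Sequences

section Rays
variable {V : Type*} {Adj : V → V → Prop} {b : V}

/-- The vertices from which the finite edge set `F` separates `b`. -/
def separated (Adj : V → V → Prop) (b : V) (F : Finset (V × V)) : Set V :=
  {v | ¬ ReflTransGen (fun x y => Adj x y ∧ (x, y) ∉ F) v b}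

theorem mem_of_leaves_separated {F : Finset (V × V)} {x y : V} (h : Adj x y)
    (hx : x ∈ separated Adj b F) (hy : y ∉ separated Adj b F) : (x, y) ∈ F := by
  by_contra hF
  have hy' : ReflTransGen (fun x y => Adj x y ∧ (x, y) ∉ F) y b := not_not.1 hy
  exact hx (hy'.head ⟨h, hF⟩)

theorem exists_diPath {r : V → V → Prop} (hr : ∀ x y, r x y → Adj x y) {u v : V}
    (h : ReflTransGen r u v) :
    ∃ P : DiPath Adj, P.first = u ∧ P.last = v ∧ ∀ e ∈ P.edgeSet, r e.1 e.2 := by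
  obtain ⟨l, hn, hc, hl⟩ := exists_nodup_isChain h
  exact ⟨⟨u :: l, List.cons_ne_nil u l, hc.imp hr, hn⟩, rfl, hl,
    rel_of_mem_zip_tail hc⟩

theorem DiPath.exists_mem_edgeSet_leaving (P : DiPath Adj) {X : Set V} (h1 : P.first ∈ X)
    (h2 : P.last ∉ X) : ∃ e ∈ P.edgeSet, Adj e.1 e.2 ∧ e.1 ∈ X ∧ e.2 ∉ X := by
  obtain ⟨l, ne, hc, hn⟩ := P
  cases l with
  | nil => exact absurd rfl ne
  | cons u l =>
    obtain ⟨e, he, h⟩ := exists_mem_zip_tail_leaving (l := l) h1 h2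
    exact ⟨e, he, rel_of_mem_zip_tail (r := Adj) hc e he, h⟩

theorem exists_disjoint_diPaths {A : Set V} (hb : b ∉ A)
    (h : ∀ F : Finset (V × V), ∃ u ∈ A, u ∉ separated Adj b F) :
    ∃ P : ℕ → DiPath Adj, Function.Injective P ∧ (∀ n, (P n).first ∈ A) ∧
      (∀ n, (P n).last = b) ∧ ∀ m n, m ≠ n → Disjoint (P m).edgeSet (P n).edgeSet := by
  classical
  have : Std.Symm (fun P Q : DiPath Adj => Disjoint P.edgeSet Q.edgeSet) :=
    ⟨fun _ _ h => h.symm⟩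
  obtain ⟨P, hP, hd⟩ := exists_seq_of_forall_finset_exists'
    (fun P : DiPath Adj => P.first ∈ A ∧ P.last = b)
    (fun P Q => Disjoint P.edgeSet Q.edgeSet) fun s _ => by
      obtain ⟨u, huA, hu⟩ := h (s.biUnion fun P => P.edges.toFinset)
      obtain ⟨Q, h1, h2, h3⟩ := exists_diPath (fun x y h => h.1) (not_not.1 hu)
      refine ⟨Q, ⟨h1 ▸ huA, h2⟩, fun P hP => Set.disjoint_left.2 fun e he he' => ?_⟩
      exact (h3 e he').2 (Finset.mem_biUnion.2 ⟨P, hP, List.mem_toFinset.2 he⟩)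
  refine ⟨P, fun m n hmn => ?_, fun n => (hP n).1, fun n => (hP n).2, fun m n hmn => hd hmn⟩
  by_contra hne
  obtain ⟨e, he, -⟩ := (P m).exists_mem_edgeSet_leaving (hP m).1 ((hP m).2 ▸ hb)
  exact Set.disjoint_left.1 (hd hne) he (hmn ▸ he)

theorem not_frequently_mem_separated {q : ℕ → V}
    (hq : ∀ n, q (n + 1) = q n ∨ Adj (q n) (q (n + 1)))
    (hinj : ∀ m n, q m ≠ q (m + 1) → q n ≠ q (n + 1) →
      (q m, q (m + 1)) = (q n, q (n + 1)) → m = n)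
    {F : Finset (V × V)} (hout : ∀ N, ∃ n, N ≤ n ∧ q n ∉ separated Adj b F)
    (hin : ∀ N, ∃ n, N ≤ n ∧ q n ∈ separated Adj b F) : False := by
  set S : Set ℕ := {n | q n ∈ separated Adj b F ∧ q (n + 1) ∉ separated Adj b F}
  have hne (n) (hn : n ∈ S) : q n ≠ q (n + 1) := fun h => hn.2 (h ▸ hn.1)
  have hSfin : S.Finite := by
    refine Set.Finite.of_finite_image (f := fun n => (q n, q (n + 1)))
      (F.finite_toSet.subset ?_) fun m hm n hn h => hinj m n (hne m hm) (hne n hn) h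
    rintro _ ⟨n, hn, rfl⟩
    exact mem_of_leaves_separated ((hq n).resolve_left fun h => hne n hn h.symm) hn.1 hn.2
  obtain ⟨N, hN⟩ := hSfin.bddAbove
  obtain ⟨m, hm, hmZ⟩ := hin (N + 1)
  have hstay (k) : q (m + k) ∈ separated Adj b F := by
    induction k with
    | zero => exact hmZ
    | succ k ih =>
      by_contra hk
      have := hN (show m + k ∈ S from ⟨ih, hk⟩)
      omega
  obtain ⟨n, hn, hnZ⟩ := hout m
  exact hnZ (by simpa [Nat.add_sub_cancel' hn] using hstay (n - m))

/-- A walk that repeats no edge and leaves every region finitely separated from `b`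
contains a path or ray that ends at `b` or dominates `b`. -/
theorem exists_good_PR {q : ℕ → V}
    (hq : ∀ n, q (n + 1) = q n ∨ Adj (q n) (q (n + 1)))
    (hinj : ∀ m n, q m ≠ q (m + 1) → q n ≠ q (n + 1) →
      (q m, q (m + 1)) = (q n, q (n + 1)) → m = n)
    (hout : ∀ F : Finset (V × V), ∀ N, ∃ n, N ≤ n ∧ q n ∉ separated Adj b F) :
    ∃ Q : PR Adj, Q.first = q 0 ∧ Q.Good b ∧
      ∀ e ∈ Q.edgeSet, ∃ n, q n ≠ q (n + 1) ∧ e = (q n, q (n + 1)) := by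
  classical
  have hpath (n) : ∃ P : DiPath Adj, P.first = q 0 ∧ P.last = q n ∧
      ∀ e ∈ P.edgeSet, ∃ n, q n ≠ q (n + 1) ∧ e = (q n, q (n + 1)) := by
    refine exists_diPath (r := fun x y => ∃ n, q n ≠ q (n + 1) ∧ (x, y) = (q n, q (n + 1))) ?_ ?_
    · rintro x y ⟨n, hn, h⟩
      obtain ⟨rfl, rfl⟩ := Prod.mk.inj h
      exact (hq n).resolve_left hn.symm
    · induction n with
      | zero => exact .refl
      | succ n ih =>
        by_cases hn : q n = q (n + 1)
        · rwa [← hn]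
        · exact ih.tail ⟨n, hn, rfl⟩
  by_cases hqb : ∃ n, q n = b
  · obtain ⟨n, rfl⟩ := hqb
    obtain ⟨P, h1, h2, h3⟩ := hpath n
    exact ⟨.path P, h1, Or.inl h2, h3⟩
  push Not at hqb
  by_cases hrec : ∃ m, ∀ N, ∃ n, N ≤ n ∧ q n = q m
  · obtain ⟨m, hm⟩ := hrec
    obtain ⟨P, h1, h2, h3⟩ := hpath m
    refine ⟨.path P, h1, Or.inr ?_, h3⟩
    obtain ⟨R, h4, h5, h6⟩ := exists_disjoint_diPaths (Adj := Adj) (b := b) (A := {q m})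
      (fun h => hqb m (Set.mem_singleton_iff.1 h).symm) fun F => ⟨q m, rfl, fun hF =>
        not_frequently_mem_separated hq hinj (hout F) fun N => by
          obtain ⟨n, hn, h⟩ := hm N
          exact ⟨n, hn, h.symm ▸ hF⟩⟩
    exact ⟨R, h4, fun n => (h5 n).trans h2.symm, h6⟩
  push Not at hrec
  have hlast (m) : ∃ n, q n = q m ∧ m ≤ n ∧ ∀ k, n < k → q k ≠ q n := by
    obtain ⟨N, hN⟩ := hrec m
    have hbdd (k) (hk : q k = q m) : k ≤ N := by
      by_contra h
      exact hN k (by omega) hk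
    have hspec : q (Nat.findGreatest (fun k => q k = q m) N) = q m :=
      Nat.findGreatest_spec (P := fun k => q k = q m) (hbdd m rfl) rfl
    refine ⟨_, hspec, Nat.le_findGreatest (hbdd m rfl) rfl, fun k hk h => ?_⟩
    exact Nat.findGreatest_is_greatest hk (hbdd k (h.trans hspec)) (h.trans hspec)
  choose last hlast1 hlast2 hlast3 using hlast
  let t : ℕ → ℕ := fun n => Nat.rec (last 0) (fun _ k => last (k + 1)) n
  have ht (n) : t (n + 1) = last (t n + 1) := rfl
  have htmax (n) : ∀ k, t n < k → q k ≠ q (t n) := by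
    cases n with
    | zero => exact hlast3 0
    | succ n => exact hlast3 _
  have htmono : StrictMono t := strictMono_nat_of_lt_succ fun n => by
    rw [ht]; exact hlast2 _
  have hqt (n) : q (t (n + 1)) = q (t n + 1) := hlast1 _
  have hmove (n) : q (t n) ≠ q (t n + 1) := (htmax n _ (Nat.lt_succ_self _)).symm
  let R : DiRay Adj :=
    { f := fun n => q (t n)
      inj := by
        intro m n hmn
        rcases lt_trichotomy m n with h | h | h
        · exact absurd hmn.symm (htmax m _ (htmono h))
        · exact h
        · exact absurd hmn (htmax n _ (htmono h))
      adj := fun n => by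
        rw [hqt]
        exact (hq (t n)).resolve_left (hmove n).symm }
  refine ⟨.ray R, hlast1 0, ?_, ?_⟩
  · refine exists_disjoint_diPaths ?_ fun F => ?_
    · rintro ⟨n, hn⟩
      exact hqb _ hn
    · by_contra! hcon
      exact not_frequently_mem_separated hq hinj (hout F) fun N =>
        ⟨t N, htmono.le_apply, hcon _ ⟨N, rfl⟩⟩
  · rintro _ ⟨n, rfl⟩
    exact ⟨t n, hmove n, by simp only [← hqt]; rfl⟩

end Rays

theorem feasible_of_finLinked {V : Type*} {Adj : V → V → Prop} {b : V} {I : Set V}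
    (hlink : ∀ S : Finset V, ↑S ⊆ I → FinLinked Adj b S) :
    Feasible b ((fun i : I => (i : V)), {e : V × V | Adj e.1 e.2}) := by
  classical
  intro X hbX
  by_contra! hlt
  obtain ⟨t, ht, htc⟩ := Set.exists_subset_encard_eq (Order.add_one_le_of_lt hlt)
  have hcut : (outCut {e : V × V | Adj e.1 e.2} X).Finite :=
    Set.encard_ne_top_iff.1 (ne_top_of_lt hlt)
  have htfin : t.Finite := by
    rw [← hcut.cast_ncard_eq] at htc
    exact Set.finite_of_encard_eq_coe (k := (outCut {e : V × V | Adj e.1 e.2} X).ncard + 1)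
      (by exact_mod_cast htc)
  obtain ⟨S, hS⟩ := (htfin.image ((↑) : I → V)).exists_finset_coe
  obtain ⟨P, h1, h2, h3⟩ := hlink S (by rw [hS]; rintro _ ⟨i, -, rfl⟩; exact i.2)
  have hSX (s : S) : (s : V) ∈ X := by
    have : (s : V) ∈ (S : Set V) := s.2
    rw [hS] at this
    obtain ⟨i, hi, h⟩ := this
    exact h ▸ ht hi
  choose f hf hfAdj hfX using fun s : S =>
    (P s).exists_mem_edgeSet_leaving (X := X) (h1 s ▸ hSX s) (h2 s ▸ hbX)
  have hinj : Function.Injective f := fun s s' h => by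
    by_contra hne
    exact Set.disjoint_left.1 (h3 s s' hne) (hf s) (h ▸ hf s')
  have hle : (Set.range f).encard ≤ (outCut {e : V × V | Adj e.1 e.2} X).encard := by
    refine Set.encard_le_encard ?_
    rintro _ ⟨s, rfl⟩
    exact ⟨hfAdj s, hfX s⟩
  have hcard : (Set.range f).encard = t.encard := by
    rw [← Set.image_univ, hinj.encard_image, ← Subtype.val_injective.encard_image t, ← hS,
      ← Subtype.val_injective.encard_image Set.univ, Set.image_univ]
    congr 1
    ext; simp
  rw [hcard, htc, ← hcut.cast_ncard_eq] at hle
  norm_cast at hle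
  omega

theorem stmt14 {V : Type*} [Countable V] (Adj : V → V → Prop) (b : V)
    (I : Set V) (hb : b ∉ I)
    (hlink : ∀ S : Finset V, ↑S ⊆ I → FinLinked Adj b S) :
    DomLinkage Adj b I := by
  classical
  have := Encodable.ofCountable (I × Finset (V × V))
  obtain ⟨s, hs0, hs, hfreq⟩ := exists_seq_of_reflTransGen (r := Step)
    (good := fun σ : (I → V) × Set (V × V) => Feasible b σ ∧ σ.2 ⊆ {e | Adj e.1 e.2})
    (D := fun k σ => ∀ i F, Encodable.encode (i, F) = k.unpair.1 → σ.1 i ∉ separated Adj b F)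
    ⟨feasible_of_finLinked hlink, subset_rfl⟩ (by
      rintro k σ ⟨hσ, hE⟩
      by_cases hk : ∃ i F, Encodable.encode (i, F) = k.unpair.1 ∧ σ.1 i ∈ separated Adj b F
      · obtain ⟨i, F, hiF, hi⟩ := hk
        obtain ⟨τ, h1, h2, h3⟩ := exists_exit hσ hi (fun h => h .refl)
          (F.finite_toSet.subset fun e he => mem_of_leaves_separated (hE he.1) he.2.1 he.2.2)
        refine ⟨τ, h1, ⟨h2, ?_⟩, fun i' F' h => ?_⟩
        · have : τ.2 ⊆ σ.2 := by
            clear h2 h3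
            induction h1 with
            | refl => exact subset_rfl
            | tail _ h ih =>
              obtain ⟨_, _, _, _, _, h⟩ := h
              exact (h ▸ Set.sdiff_subset).trans ih
          exact this.trans hE
        · obtain ⟨rfl, rfl⟩ := Prod.mk.inj (Encodable.encode_injective (h.trans hiF.symm))
          exact h3
      · push Not at hk
        exact ⟨σ, .refl, ⟨hσ, hE⟩, hk⟩)
  have hanti : Antitone fun n => (s n).2 := antitone_nat_of_succ_le fun n => by
    rcases hs n with h | ⟨_, _, _, _, _, h⟩
    · rw [h]
    · rw [h]; exact Set.sdiff_subset
  have hmove {n : ℕ} {i : I} (h : (s n).1 i ≠ (s (n + 1)).1 i) :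
      ((s n).1 i, (s (n + 1)).1 i) ∈ (s n).2 ∧
      ((s n).1 i, (s (n + 1)).1 i) ∉ (s (n + 1)).2 ∧
      ∀ j, j ≠ i → (s (n + 1)).1 j = (s n).1 j := by
    rcases hs n with h' | ⟨i', y, h1, h2, h3, h4⟩
    · exact absurd (by rw [h']) h
    · obtain rfl : i = i' := by
        by_contra hne
        exact h (h2 i hne).symm
      rw [h3, h4]
      exact ⟨h1, fun h => h.2 rfl, h2⟩
  have huniq {m n : ℕ} {i j : I} (hm : (s m).1 i ≠ (s (m + 1)).1 i)
      (hn : (s n).1 j ≠ (s (n + 1)).1 j)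
      (h : ((s m).1 i, (s (m + 1)).1 i) = ((s n).1 j, (s (n + 1)).1 j)) : m = n ∧ i = j := by
    obtain rfl : m = n := by
      rcases lt_trichotomy m n with hlt | rfl | hlt
      · exact absurd (hanti (Nat.succ_le_of_lt hlt) (h ▸ (hmove hn).1)) (hmove hm).2.1
      · rfl
      · exact absurd (hanti (Nat.succ_le_of_lt hlt) (h ▸ (hmove hm).1)) (hmove hn).2.1
    refine ⟨rfl, ?_⟩
    by_contra hne
    exact hm ((hmove hn).2.2 i hne).symm
  have hE (n) : (s n).2 ⊆ {e | Adj e.1 e.2} := by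
    have := hanti (Nat.zero_le n)
    simpa only [hs0] using this
  have hPR (i : I) := exists_good_PR (Adj := Adj) (b := b) (q := fun n => (s n).1 i)
    (fun n => by
      by_cases h : (s n).1 i = (s (n + 1)).1 i
      · exact Or.inl h.symm
      · exact Or.inr (hE n (hmove h).1))
    (fun m n hm hn h => (huniq hm hn h).1)
    (fun F N => by
      obtain ⟨n, hn, h⟩ := hfreq (Nat.pair (Encodable.encode (i, F)) N)
      exact ⟨n, (Nat.right_le_pair _ _).trans hn, h i F (by rw [Nat.unpair_pair])⟩)
  choose Q hQ1 hQ2 hQ3 using hPR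
  refine ⟨Q, fun i => ?_, hQ2, fun i j hij => Set.disjoint_left.2 fun e he he' => ?_⟩
  · rw [hQ1, hs0]
  · obtain ⟨m, hm, h⟩ := hQ3 i e he
    obtain ⟨n, hn, h'⟩ := hQ3 j e he'
    exact hij (huniq hm hn (h.symm.trans h')).2
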